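/- Define the index I_a = E[(1/σ_a) · φ((θ_a* − μ_a)/σ_a)] for each arm a, and note I_a > 0. Suppose there exist ε > 0 and α₁ > 0 such that for each α ∈ (0, α₁) there is a maximizer ρ(α) of V(·, α) over Δ_K satisfying ρ(α)_a > ε for every arm a. Then ρ(α) converges as α → 0⁺, and for every arm a, lim_{α → 0⁺} ρ(α)_a = s_a · sqrt(I_a) / Σ_{a'=1}^{K} s_{a'} · sqrt(I_{a'}) (the Density Thompson Sampling allocation). -/

import Mathlib

open MeasureTheory ProbabilityTheory Filter Topology

/-- Product of `K` independent standard Gaussians on `Fin K → ℝ`. -/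
noncomputable def gaussPi (K : ℕ) : Measure (Fin K → ℝ) :=
  Measure.pi fun _ => gaussianReal 0 1

/-- Standard normal density `φ`. -/
noncomputable def stdNormalPDF (x : ℝ) : ℝ :=
  (Real.sqrt (2 * Real.pi))⁻¹ * Real.exp (-(x ^ 2) / 2)

/-- Scaled planning objective
`V(ρ, α) = E[max_a { μ_a + σ_a sqrt(ρ_a σ_a² / (α s_a² + ρ_a σ_a²)) Z_a }]`. -/
noncomputable def Vplan (K : ℕ) (μ σ s : Fin K → ℝ) (ρ : Fin K → ℝ) (α : ℝ) : ℝ :=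
  ∫ z, (⨆ a, (μ a + σ a * Real.sqrt (ρ a * (σ a) ^ 2
      / (α * (s a) ^ 2 + ρ a * (σ a) ^ 2)) * z a)) ∂(gaussPi K)

instance (K : ℕ) : IsProbabilityMeasure (gaussPi K) := by
  unfold gaussPi; infer_instance

lemma gaussianPDFReal_zero_one (x : ℝ) : gaussianPDFReal 0 1 x = stdNormalPDF x := by
  simp [gaussianPDFReal, stdNormalPDF]

lemma stdNormalPDF_pos (x : ℝ) : 0 < stdNormalPDF x := by
  unfold stdNormalPDF; positivity

lemma stdNormalPDF_le (x : ℝ) : stdNormalPDF x ≤ (Real.sqrt (2 * Real.pi))⁻¹ := by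
  unfold stdNormalPDF
  refine mul_le_of_le_one_right (by positivity) (Real.exp_le_one_iff.2 ?_)
  nlinarith [sq_nonneg x]

lemma continuous_stdNormalPDF : Continuous stdNormalPDF := by
  unfold stdNormalPDF; fun_prop

lemma hasDerivAt_stdNormalPDF (x : ℝ) :
    HasDerivAt stdNormalPDF (-(x * stdNormalPDF x)) x := by
  unfold stdNormalPDF
  have h : HasDerivAt (fun x : ℝ => -(x ^ 2) / 2) (-x) x := by
    refine (((hasDerivAt_pow 2 x).neg).div_const 2).congr_deriv ?_
    norm_num
    ring
  exact ((h.exp).const_mul _).congr_deriv (by ring)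

lemma tendsto_stdNormalPDF_atTop : Tendsto stdNormalPDF atTop (𝓝 0) := by
  unfold stdNormalPDF
  have h : Tendsto (fun x : ℝ => -(x ^ 2) / 2) atTop atBot := by
    refine (tendsto_neg_atTop_atBot.comp (tendsto_pow_atTop (α := ℝ) two_ne_zero)).atBot_div_const
      two_pos
  simpa using (Real.tendsto_exp_atBot.comp h).const_mul (Real.sqrt (2 * Real.pi))⁻¹

lemma integrable_mul_stdNormalPDF : Integrable (fun x : ℝ => x * stdNormalPDF x) := by
  refine ((integrable_mul_exp_neg_mul_sq (b := 1 / 2) (by norm_num)).const_mul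
    (Real.sqrt (2 * Real.pi))⁻¹).congr (ae_of_all _ fun x => ?_)
  simp only [stdNormalPDF]
  rw [show -(1 / 2 : ℝ) * x ^ 2 = -(x ^ 2) / 2 by ring]
  ring

/-- The truncated mean of a standard normal variable: `E[X; X > y] = φ(y)`. -/
lemma integral_indicator_Ioi_gaussianReal (y : ℝ) :
    ∫ x, (Set.Ioi y).indicator id x ∂gaussianReal 0 1 = stdNormalPDF y := by
  rw [integral_gaussianReal_eq_integral_smul one_ne_zero]
  have h : ∀ x, gaussianPDFReal 0 1 x • (Set.Ioi y).indicator id x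
      = (Set.Ioi y).indicator (fun x => x * stdNormalPDF x) x := by
    intro x
    rw [gaussianPDFReal_zero_one]
    by_cases hx : x ∈ Set.Ioi y <;> simp [hx, mul_comm]
  simp_rw [h]
  rw [integral_indicator measurableSet_Ioi]
  have := integral_Ioi_of_hasDerivAt_of_tendsto' (a := y) (f := fun x => -stdNormalPDF x)
    (f' := fun x => x * stdNormalPDF x) (m := 0)
    (fun x _ => ((hasDerivAt_stdNormalPDF x).neg).congr_deriv (by ring))
    integrable_mul_stdNormalPDF.integrableOn
    (by simpa using tendsto_stdNormalPDF_atTop.neg)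
  simpa using this

lemma integrable_id_gaussianReal : Integrable (fun x : ℝ => x) (gaussianReal 0 1) :=
  (memLp_id_gaussianReal 1).integrable (by simp)

section Independence

variable {Ω : Type*} [MeasurableSpace Ω] {P : Measure Ω} [IsProbabilityMeasure P] {X Y : Ω → ℝ}

lemma ae_ne_of_indepFun_gaussianReal (hX : Measurable X) (hY : Measurable Y)
    (hlaw : P.map X = gaussianReal 0 1) (hind : IndepFun Y X P) : ∀ᵐ ω ∂P, X ω ≠ Y ω := by
  have hprod := (indepFun_iff_map_prod_eq_prod_map_map hY.aemeasurable hX.aemeasurable).1 hind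
  have hs : MeasurableSet {p : ℝ × ℝ | p.2 = p.1} :=
    measurableSet_eq_fun measurable_snd measurable_fst
  have := nullSingletonClass_gaussianReal (μ := 0) (v := 1) one_ne_zero
  have h0 : (P.map fun ω => (Y ω, X ω)) {p : ℝ × ℝ | p.2 = p.1} = 0 := by
    rw [hprod, hlaw]
    have := Measure.isProbabilityMeasure_map (μ := P) hY.aemeasurable
    rw [Measure.measure_prod_null hs]
    refine ae_of_all _ fun y => ?_
    have : Prod.mk y ⁻¹' {p : ℝ × ℝ | p.2 = p.1} = {y} := by ext x; simp
    simp [this]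
  rw [Measure.map_apply (hY.prodMk hX) hs] at h0
  rw [ae_iff]
  simpa using h0

/-- Gaussian integration by parts for the event `Y < X`, with `Y` independent of `X`. -/
lemma integral_indicator_lt_of_indepFun_gaussianReal (hX : Measurable X) (hY : Measurable Y)
    (hlaw : P.map X = gaussianReal 0 1) (hind : IndepFun Y X P) :
    ∫ ω, {ω | Y ω < X ω}.indicator X ω ∂P = ∫ ω, stdNormalPDF (Y ω) ∂P := by
  have hprod := (indepFun_iff_map_prod_eq_prod_map_map hY.aemeasurable hX.aemeasurable).1 hind
  have hs : MeasurableSet {p : ℝ × ℝ | p.1 < p.2} := measurableSet_lt measurable_fst measurable_snd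
  have := Measure.isProbabilityMeasure_map (μ := P) hY.aemeasurable
  have hmeas : Measurable ({p : ℝ × ℝ | p.1 < p.2}.indicator Prod.snd) :=
    measurable_snd.indicator hs
  calc ∫ ω, {ω | Y ω < X ω}.indicator X ω ∂P
      = ∫ p, {p : ℝ × ℝ | p.1 < p.2}.indicator Prod.snd p ∂(P.map fun ω => (Y ω, X ω)) := by
        rw [integral_map (hY.prodMk hX).aemeasurable hmeas.aestronglyMeasurable]
        rfl
    _ = ∫ y, stdNormalPDF y ∂(P.map Y) := by
        rw [hprod, hlaw, integral_prod]
        · refine integral_congr_ae (ae_of_all _ fun y => ?_)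
          exact integral_indicator_Ioi_gaussianReal y
        · exact (integrable_id_gaussianReal.comp_snd (P.map Y)).indicator hs
    _ = _ := integral_map hY.aemeasurable continuous_stdNormalPDF.aestronglyMeasurable

end Independence

/-- The standardized level that arm `a` must exceed to beat every other arm. -/
noncomputable def rivalLevel {K : ℕ} (μ σ : Fin K → ℝ) (a : Fin K) (z : Fin K → ℝ) : ℝ :=
  ((⨆ a' : {b : Fin K // b ≠ a}, (μ a'.1 + σ a'.1 * z a'.1)) - μ a) / σ a

section Planning

variable {K : ℕ}

lemma measurable_rivalLevel (μ σ : Fin K → ℝ) (a : Fin K) : Measurable (rivalLevel μ σ a) := by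
  unfold rivalLevel
  refine ((Measurable.iSup fun a' => ?_).sub_const _).div_const _
  fun_prop

lemma map_eval_gaussPi (a : Fin K) : (gaussPi K).map (fun z => z a) = gaussianReal 0 1 :=
  (measurePreserving_eval (fun _ : Fin K => gaussianReal 0 1) a).map_eq

lemma integrable_eval_gaussPi (a : Fin K) : Integrable (fun z => z a) (gaussPi K) :=
  integrable_comp_eval (μ := fun _ : Fin K => gaussianReal 0 1) integrable_id_gaussianReal

lemma indepFun_rivalLevel_eval (μ σ : Fin K → ℝ) (a : Fin K) :
    IndepFun (rivalLevel μ σ a) (fun z => z a) (gaussPi K) := by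
  have h : iIndepFun (fun (i : Fin K) (z : Fin K → ℝ) => z i) (gaussPi K) :=
    iIndepFun_pi (μ := fun _ : Fin K => gaussianReal 0 1) (X := fun _ x => x)
      fun _ => aemeasurable_id
  have h2 := h.indepFun_finset {a}ᶜ {a} disjoint_compl_left fun i => measurable_pi_apply i
  have hmem : ∀ b : {b : Fin K // b ≠ a}, b.1 ∈ ({a}ᶜ : Finset (Fin K)) := fun b => by
    simpa using b.2
  let g : ((i : ({a}ᶜ : Finset (Fin K))) → ℝ) → ℝ := fun w =>
    ((⨆ b : {b : Fin K // b ≠ a}, (μ b.1 + σ b.1 * w ⟨b.1, hmem b⟩)) - μ a) / σ a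
  have hg : Measurable g :=
    ((Measurable.iSup fun b => by fun_prop).sub_const _).div_const _
  exact h2.comp hg (measurable_pi_apply (⟨a, Finset.mem_singleton_self a⟩ : ({a} : Finset (Fin K))))

lemma ae_eval_ne_rivalLevel (μ σ : Fin K → ℝ) :
    ∀ᵐ z ∂gaussPi K, ∀ a, z a ≠ rivalLevel μ σ a z :=
  ae_all_iff.2 fun a => ae_ne_of_indepFun_gaussianReal (measurable_pi_apply a)
    (measurable_rivalLevel μ σ a) (map_eval_gaussPi a) (indepFun_rivalLevel_eval μ σ a)

/-- The posterior-mean maximum `max_a (μ_a + c_a z_a)` with scales `c`. -/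
noncomputable def maxMean (μ : Fin K → ℝ) (c z : Fin K → ℝ) : ℝ := ⨆ a, (μ a + c a * z a)

lemma measurable_maxMean (μ c : Fin K → ℝ) : Measurable (maxMean μ c) := by
  unfold maxMean
  exact Measurable.iSup fun a => by fun_prop

lemma maxMean_le_add [Nonempty (Fin K)] (μ c d z : Fin K → ℝ) :
    maxMean μ c z ≤ maxMean μ d z + ‖c - d‖ * ∑ a, |z a| := by
  refine ciSup_le fun a => ?_
  have h1 : μ a + d a * z a ≤ maxMean μ d z :=
    le_ciSup (f := fun a => μ a + d a * z a) (Set.finite_range _).bddAbove a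
  have h2 : (c a - d a) * z a ≤ ‖c - d‖ * ∑ b, |z b| := by
    refine (le_abs_self _).trans ?_
    rw [abs_mul]
    gcongr
    · exact norm_le_pi_norm (c - d) a
    · exact Finset.single_le_sum (f := fun b => |z b|) (fun b _ => abs_nonneg _)
        (Finset.mem_univ a)
  linarith

lemma lipschitzWith_maxMean [Nonempty (Fin K)] (μ z : Fin K → ℝ) :
    LipschitzWith (Real.nnabs (∑ a, |z a|)) (fun c => maxMean μ c z) := by
  refine LipschitzWith.of_dist_le_mul fun c d => ?_
  have hn : 0 ≤ ∑ a, |z a| := Finset.sum_nonneg fun a _ => abs_nonneg _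
  rw [Real.dist_eq, dist_eq_norm, Real.coe_nnabs, abs_of_nonneg hn, abs_le]
  have h1 := maxMean_le_add μ c d z
  have h2 := maxMean_le_add μ d c z
  rw [norm_sub_rev] at h2
  constructor <;> linarith

lemma integrable_sum_abs_gaussPi : Integrable (fun z : Fin K → ℝ => ∑ a, |z a|) (gaussPi K) :=
  integrable_finsetSum _ fun a _ => (integrable_eval_gaussPi a).abs

lemma integrable_maxMean [Nonempty (Fin K)] (μ c : Fin K → ℝ) :
    Integrable (maxMean μ c) (gaussPi K) := by
  refine Integrable.mono' (g := fun z => |maxMean μ 0 0| + ‖c‖ * ∑ a, |z a|)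
    ((integrable_const _).add (integrable_sum_abs_gaussPi.const_mul _))
    (measurable_maxMean μ c).aestronglyMeasurable (ae_of_all _ fun z => ?_)
  have h0 : maxMean μ 0 z = maxMean μ 0 0 := by simp [maxMean]
  have h1 := maxMean_le_add μ c 0 z
  have h2 := maxMean_le_add μ 0 c z
  rw [zero_sub, norm_neg] at h2
  rw [sub_zero] at h1
  rw [h0] at h1 h2
  rw [Real.norm_eq_abs, abs_le]
  constructor <;> linarith [neg_abs_le (maxMean μ 0 0), le_abs_self (maxMean μ 0 0)]

/-- The derivative of `c ↦ max_a (μ_a + c_a z_a)` at `σ`, off ties. -/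
noncomputable def maxMeanDeriv (μ σ z : Fin K → ℝ) : (Fin K → ℝ) →L[ℝ] ℝ :=
  ∑ a, {z | rivalLevel μ σ a z < z a}.indicator (fun z => z a) z •
    ContinuousLinearMap.proj (R := ℝ) (φ := fun _ : Fin K => ℝ) a

lemma rivalLevel_lt_iff {μ σ : Fin K → ℝ} (hσ : ∀ a, 0 < σ a) [Nontrivial (Fin K)] (a : Fin K)
    (z : Fin K → ℝ) :
    rivalLevel μ σ a z < z a ↔ ∀ b, b ≠ a → μ b + σ b * z b < μ a + σ a * z a := by
  have : Nonempty {b : Fin K // b ≠ a} := (exists_ne a).elim fun b hb => ⟨⟨b, hb⟩⟩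
  rw [rivalLevel, div_lt_iff₀ (hσ a), sub_lt_iff_lt_add', mul_comm (z a)]
  constructor
  · intro h b hb
    exact (le_ciSup (f := fun a' : {b : Fin K // b ≠ a} => μ a'.1 + σ a'.1 * z a'.1)
      (Set.finite_range _).bddAbove ⟨b, hb⟩).trans_lt h
  · intro h
    obtain ⟨b, hb⟩ := exists_eq_ciSup_of_finite
      (f := fun a' : {b : Fin K // b ≠ a} => μ a'.1 + σ a'.1 * z a'.1)
    rw [← hb]
    exact h b.1 b.2

lemma exists_rivalLevel_le {μ σ : Fin K → ℝ} (hσ : ∀ a, 0 < σ a) [Nontrivial (Fin K)]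
    (z : Fin K → ℝ) : ∃ a, rivalLevel μ σ a z ≤ z a := by
  obtain ⟨a, ha⟩ := exists_eq_ciSup_of_finite (f := fun a => μ a + σ a * z a)
  have : Nonempty {b : Fin K // b ≠ a} := (exists_ne a).elim fun b hb => ⟨⟨b, hb⟩⟩
  refine ⟨a, ?_⟩
  rw [rivalLevel, div_le_iff₀ (hσ a), sub_le_iff_le_add', mul_comm (z a)]
  refine ciSup_le fun b => ?_
  have := le_ciSup (f := fun a => μ a + σ a * z a) (Set.finite_range _).bddAbove b.1
  exact this.trans ha.ge

lemma hasFDerivAt_maxMean {μ σ : Fin K → ℝ} (hσ : ∀ a, 0 < σ a) [Nontrivial (Fin K)]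
    {z : Fin K → ℝ} (hz : ∀ a, z a ≠ rivalLevel μ σ a z) :
    HasFDerivAt (fun c => maxMean μ c z) (maxMeanDeriv μ σ z) σ := by
  obtain ⟨a, ha⟩ := exists_rivalLevel_le (μ := μ) hσ z
  have hlt := lt_of_le_of_ne ha (hz a).symm
  have hwin := (rivalLevel_lt_iff hσ a z).1 hlt
  have hD : maxMeanDeriv μ σ z
      = z a • ContinuousLinearMap.proj (R := ℝ) (φ := fun _ : Fin K => ℝ) a := by
    rw [maxMeanDeriv, Finset.sum_eq_single a]
    · rw [Set.indicator_of_mem (by exact hlt)]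
    · intro b _ hb
      rw [Set.indicator_of_notMem, zero_smul]
      intro hb'
      exact lt_asymm (hwin b hb) ((rivalLevel_lt_iff hσ b z).1 hb' a hb.symm)
    · simp
  have hev : ∀ᶠ c in 𝓝 σ, maxMean μ c z = μ a + c a * z a := by
    have : ∀ᶠ c in 𝓝 σ, ∀ b, b ≠ a → μ b + c b * z b < μ a + c a * z a := by
      refine eventually_all.2 fun b => ?_
      by_cases hb : b = a
      · simp [hb]
      · have h1 : ContinuousAt (fun c : Fin K → ℝ => μ b + c b * z b) σ :=
          (((continuous_apply b).mul continuous_const).const_add _).continuousAt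
        have h2 : ContinuousAt (fun c : Fin K → ℝ => μ a + c a * z a) σ :=
          (((continuous_apply a).mul continuous_const).const_add _).continuousAt
        filter_upwards [h1.eventually_lt h2 (hwin b hb)] with c hc _ using hc
    filter_upwards [this] with c hc
    refine le_antisymm (ciSup_le fun b => ?_)
      (le_ciSup (f := fun a => μ a + c a * z a) (Set.finite_range _).bddAbove a)
    by_cases hb : b = a
    · rw [hb]
    · exact (hc b hb).le
  rw [hD]
  refine HasFDerivAt.congr_of_eventuallyEq ?_ hev
  have := ((ContinuousLinearMap.proj (R := ℝ) (φ := fun _ : Fin K => ℝ) a).hasFDerivAt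
    (x := σ)).mul_const (z a)
  exact this.const_add (μ a)

lemma integrable_indicator_rivalLevel (μ σ : Fin K → ℝ) (a : Fin K) :
    Integrable (fun z => {z | rivalLevel μ σ a z < z a}.indicator (fun z => z a) z)
      (gaussPi K) :=
  (integrable_eval_gaussPi a).indicator
    (measurableSet_lt (measurable_rivalLevel μ σ a) (measurable_pi_apply a))

lemma integrable_maxMeanDeriv (μ σ : Fin K → ℝ) :
    Integrable (maxMeanDeriv μ σ) (gaussPi K) := by
  have h (a : Fin K) := (integrable_indicator_rivalLevel μ σ a).smul_const
    (ContinuousLinearMap.proj (R := ℝ) (φ := fun _ : Fin K => ℝ) a)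
  exact integrable_finsetSum Finset.univ fun a _ => h a

lemma integral_maxMeanDeriv (μ σ : Fin K → ℝ) :
    ∫ z, maxMeanDeriv μ σ z ∂gaussPi K
      = ∑ a, (∫ z, stdNormalPDF (rivalLevel μ σ a z) ∂gaussPi K) •
        ContinuousLinearMap.proj (R := ℝ) (φ := fun _ : Fin K => ℝ) a := by
  unfold maxMeanDeriv
  rw [integral_finsetSum _ fun a _ => (integrable_indicator_rivalLevel μ σ a).smul_const _]
  refine Finset.sum_congr rfl fun a _ => ?_
  rw [integral_smul_const, integral_indicator_lt_of_indepFun_gaussianReal (measurable_pi_apply a)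
    (measurable_rivalLevel μ σ a) (map_eval_gaussPi a) (indepFun_rivalLevel_eval μ σ a)]

lemma hasFDerivAt_integral_maxMean {μ σ : Fin K → ℝ} (hσ : ∀ a, 0 < σ a)
    [Nontrivial (Fin K)] :
    HasFDerivAt (fun c => ∫ z, maxMean μ c z ∂gaussPi K)
      (∑ a, (∫ z, stdNormalPDF (rivalLevel μ σ a z) ∂gaussPi K) •
        ContinuousLinearMap.proj (R := ℝ) (φ := fun _ : Fin K => ℝ) a) σ := by
  rw [← integral_maxMeanDeriv]
  refine (hasFDerivAt_integral_of_dominated_loc_of_lip (bound := fun z => ∑ a, |z a|)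
    univ_mem (Eventually.of_forall fun c => (measurable_maxMean μ c).aestronglyMeasurable)
    (integrable_maxMean μ σ) ?_
    (ae_of_all _ fun z => (lipschitzWith_maxMean μ z).lipschitzOnWith)
    integrable_sum_abs_gaussPi ?_).2
  · exact (integrable_maxMeanDeriv μ σ).aestronglyMeasurable
  · filter_upwards [ae_eval_ne_rivalLevel μ σ] with z hz using hasFDerivAt_maxMean hσ hz

lemma integral_stdNormalPDF_rivalLevel_pos (μ σ : Fin K → ℝ) (a : Fin K) :
    0 < ∫ z, stdNormalPDF (rivalLevel μ σ a z) ∂gaussPi K := by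
  have hint : Integrable (fun z => stdNormalPDF (rivalLevel μ σ a z)) (gaussPi K) := by
    refine Integrable.of_bound (continuous_stdNormalPDF.measurable.comp
      (measurable_rivalLevel μ σ a)).aestronglyMeasurable (Real.sqrt (2 * Real.pi))⁻¹
      (ae_of_all _ fun z => ?_)
    rw [Real.norm_of_nonneg (stdNormalPDF_pos _).le]
    exact stdNormalPDF_le _
  rw [integral_pos_iff_support_of_nonneg (fun z => (stdNormalPDF_pos _).le) hint]
  have : Function.support (fun z => stdNormalPDF (rivalLevel μ σ a z)) = Set.univ :=
    Set.eq_univ_of_forall fun z => (stdNormalPDF_pos _).ne'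
  rw [this]
  simp

lemma abs_inv_sqrt_one_add_sub_le {t : ℝ} (ht : 0 ≤ t) :
    |(Real.sqrt (1 + t))⁻¹ - 1 + t / 2| ≤ 3 / 8 * t ^ 2 := by
  obtain ⟨u, hu⟩ : ∃ u, u = Real.sqrt (1 + t) := ⟨_, rfl⟩
  have hu1 : 1 ≤ u := hu ▸ Real.one_le_sqrt.2 (by linarith)
  have hut : t = u ^ 2 - 1 := by rw [hu, Real.sq_sqrt (by linarith)]; ring
  rw [← hu, hut]
  have h0 : 0 < u := by linarith
  have key : u⁻¹ - 1 + (u ^ 2 - 1) / 2 = (u - 1) ^ 2 * ((u + 2) / (2 * u)) := by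
    field_simp
    ring
  rw [key, abs_of_nonneg (by positivity)]
  have h1 : (u + 2) / (2 * u) ≤ 3 / 2 := by
    rw [div_le_iff₀ (by positivity)]
    linarith
  calc (u - 1) ^ 2 * ((u + 2) / (2 * u)) ≤ (u - 1) ^ 2 * (3 / 2) := by gcongr
    _ ≤ 3 / 8 * (u ^ 2 - 1) ^ 2 := by
      have : (u - 1) ^ 2 * 4 ≤ (u - 1) ^ 2 * (u + 1) ^ 2 := by
        gcongr
        nlinarith
      nlinarith

/-- The scale `σ_a sqrt(ρ_a σ_a² / (α s_a² + ρ_a σ_a²))` of the posterior mean of one arm. -/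
noncomputable def planScale (σ s ρ α : ℝ) : ℝ :=
  σ * Real.sqrt (ρ * σ ^ 2 / (α * s ^ 2 + ρ * σ ^ 2))

lemma abs_planScale_sub_le {σ s ρ α ε : ℝ} (hσ : 0 < σ) (hε : 0 < ε) (hρ : ε < ρ)
    (hα : 0 < α) :
    |planScale σ s ρ α - σ + α * (s ^ 2 / (2 * ρ * σ))|
      ≤ σ * (3 / 8) * (s ^ 2 / (ε * σ ^ 2)) ^ 2 * α ^ 2 := by
  have hρ0 : 0 < ρ := hε.trans hρ
  obtain ⟨t, ht⟩ : ∃ t, t = α * s ^ 2 / (ρ * σ ^ 2) := ⟨_, rfl⟩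
  have ht0 : 0 ≤ t := ht ▸ by positivity
  have hq : ρ * σ ^ 2 / (α * s ^ 2 + ρ * σ ^ 2) = (1 + t)⁻¹ := by
    rw [ht]
    field_simp
    ring
  have hle : t ≤ s ^ 2 / (ε * σ ^ 2) * α := by
    rw [ht, mul_comm α, mul_div_right_comm]
    gcongr
  have hsplit : planScale σ s ρ α - σ + α * (s ^ 2 / (2 * ρ * σ))
      = σ * ((Real.sqrt (1 + t))⁻¹ - 1 + t / 2) := by
    rw [planScale, hq, Real.sqrt_inv, ht]
    field_simp
  rw [hsplit, abs_mul, abs_of_pos hσ]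
  calc σ * |(Real.sqrt (1 + t))⁻¹ - 1 + t / 2| ≤ σ * (3 / 8 * t ^ 2) := by
        gcongr
        exact abs_inv_sqrt_one_add_sub_le ht0
    _ ≤ σ * (3 / 8 * (s ^ 2 / (ε * σ ^ 2) * α) ^ 2) := by gcongr
    _ = _ := by ring

section Expansion

open Asymptotics

variable {σ s ε : ℝ} {r : ℝ → ℝ}

lemma planScale_sub_isLittleO (hσ : 0 < σ) (hε : 0 < ε)
    (hr : ∀ᶠ α in 𝓝[>] (0 : ℝ), ε < r α) :
    (fun α => planScale σ s (r α) α - σ + α * (s ^ 2 / (2 * r α * σ)))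
      =o[𝓝[>] (0 : ℝ)] fun α => α := by
  have h : (fun α => planScale σ s (r α) α - σ + α * (s ^ 2 / (2 * r α * σ)))
      =O[𝓝[>] (0 : ℝ)] fun α => α ^ 2 := by
    refine IsBigO.of_bound (σ * (3 / 8) * (s ^ 2 / (ε * σ ^ 2)) ^ 2) ?_
    filter_upwards [hr, self_mem_nhdsWithin] with α h1 h2
    rw [Real.norm_eq_abs, norm_pow, Real.norm_eq_abs, sq_abs]
    exact abs_planScale_sub_le hσ hε h1 h2
  refine h.trans_isLittleO ?_
  exact ((isLittleO_pow_id (𝕜 := ℝ) one_lt_two).mono nhdsWithin_le_nhds)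

lemma planScale_sub_isBigO (hσ : 0 < σ) (hε : 0 < ε)
    (hr : ∀ᶠ α in 𝓝[>] (0 : ℝ), ε < r α) :
    (fun α => planScale σ s (r α) α - σ) =O[𝓝[>] (0 : ℝ)] fun α => α := by
  have h : (fun α => α * (s ^ 2 / (2 * r α * σ))) =O[𝓝[>] (0 : ℝ)] fun α => α := by
    refine IsBigO.of_bound (s ^ 2 / (2 * ε * σ)) ?_
    filter_upwards [hr] with α hα
    have : 0 < r α := hε.trans hα
    rw [norm_mul, mul_comm, Real.norm_of_nonneg (by positivity)]
    gcongr
  exact ((planScale_sub_isLittleO (s := s) hσ hε hr).isBigO.sub h).congr_left fun α => by ring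

end Expansion

open Asymptotics in
/-- First-order expansion of the planning objective in the inverse budget, along allocations
bounded away from the boundary of the simplex. -/
lemma Vplan_expansion_isLittleO [Nontrivial (Fin K)] {μ σ s : Fin K → ℝ} (hσ : ∀ a, 0 < σ a)
    {ε : ℝ} (hε : 0 < ε) {r : ℝ → Fin K → ℝ}
    (hr : ∀ᶠ α in 𝓝[>] (0 : ℝ), ∀ a, ε < r α a) :
    (fun α => Vplan K μ σ s (r α) α - (∫ z, maxMean μ σ z ∂gaussPi K)
        + α * ∑ a, s a ^ 2 / (2 * r α a * σ a) *
          ∫ z, stdNormalPDF (rivalLevel μ σ a z) ∂gaussPi K)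
      =o[𝓝[>] (0 : ℝ)] fun α => α := by
  obtain ⟨J, hJ⟩ : ∃ J : Fin K → ℝ, ∀ a,
      ∫ z, stdNormalPDF (rivalLevel μ σ a z) ∂gaussPi K = J a := ⟨_, fun _ => rfl⟩
  let c : ℝ → Fin K → ℝ := fun α a => planScale (σ a) (s a) (r α a) α
  have hr' (a : Fin K) : ∀ᶠ α in 𝓝[>] (0 : ℝ), ε < r α a := hr.mono fun α h => h a
  have hcO : (fun α => c α - σ) =O[𝓝[>] (0 : ℝ)] fun α => α :=
    isBigO_pi.2 fun a => planScale_sub_isBigO (hσ a) hε (hr' a)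
  have hc : Tendsto c (𝓝[>] 0) (𝓝 σ) := by
    have h0 : Tendsto (fun α : ℝ => α) (𝓝[>] 0) (𝓝 0) :=
      tendsto_id.mono_left nhdsWithin_le_nhds
    exact tendsto_sub_nhds_zero_iff.1 (hcO.trans_tendsto h0)
  have h1 := ((hasFDerivAt_integral_maxMean (μ := μ) hσ).isLittleO.comp_tendsto hc).trans_isBigO
    hcO
  have h2 : (fun α => ∑ a, J a * (c α a - σ a + α * (s a ^ 2 / (2 * r α a * σ a))))
      =o[𝓝[>] (0 : ℝ)] fun α => α :=
    IsLittleO.fun_sum fun a _ => (planScale_sub_isLittleO (hσ a) hε (hr' a)).const_mul_left (J a)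
  refine (h1.add h2).congr_left fun α => ?_
  have hV : Vplan K μ σ s (r α) α = ∫ z, maxMean μ (c α) z ∂gaussPi K := rfl
  simp only [hJ, hV, Function.comp_apply, sum_apply,
    smul_apply, ContinuousLinearMap.proj_apply, Pi.sub_apply, smul_eq_mul,
    mul_add, Finset.sum_add_distrib, Finset.mul_sum]
  have : ∑ a, J a * (α * (s a ^ 2 / (2 * r α a * σ a)))
      = ∑ a, α * (s a ^ 2 / (2 * r α a * σ a) * J a) :=
    Finset.sum_congr rfl fun a _ => by ring
  rw [this]
  ring

end Planning

/-- Quantitative Cauchy-Schwarz: the excess of `∑ w²/ρ` over its minimum `(∑ w)²` on the simplex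
controls the distance to the minimizer. -/
lemma sq_sub_le_sum_sq_div {ι : Type*} [Fintype ι] {w ρ : ι → ℝ} (hρ : ∀ a, 0 < ρ a)
    (hsum : ∑ a, ρ a = 1) (a : ι) :
    (w a - ρ a * ∑ b, w b) ^ 2 ≤ ∑ b, w b ^ 2 / ρ b - (∑ b, w b) ^ 2 := by
  obtain ⟨S, hS⟩ : ∃ S, S = ∑ b, w b := ⟨_, rfl⟩
  have hle : ∀ b, ρ b ≤ 1 := fun b =>
    hsum ▸ Finset.single_le_sum (fun b _ => (hρ b).le) (Finset.mem_univ b)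
  have key : ∑ b, (w b - ρ b * S) ^ 2 / ρ b = ∑ b, w b ^ 2 / ρ b - S ^ 2 := by
    have h (b : ι) : (w b - ρ b * S) ^ 2 / ρ b
        = w b ^ 2 / ρ b - 2 * S * w b + S ^ 2 * ρ b := by
      have := (hρ b).ne'
      field_simp
      ring
    simp_rw [h]
    rw [Finset.sum_add_distrib, Finset.sum_sub_distrib, ← Finset.mul_sum, ← Finset.mul_sum,
      hsum, ← hS]
    ring
  rw [← hS, ← key]
  calc (w a - ρ a * S) ^ 2 ≤ (w a - ρ a * S) ^ 2 / ρ a :=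
        le_div_self (sq_nonneg _) (hρ a) (hle a)
    _ ≤ _ := Finset.single_le_sum (f := fun b => (w b - ρ b * S) ^ 2 / ρ b)
        (fun b _ => div_nonneg (sq_nonneg _) (hρ b).le) (Finset.mem_univ a)

/-- With indices `I_a = E[(1/σ_a) φ((θ_a* − μ_a)/σ_a)] > 0`
(`θ_a* = max_{a'≠a}(μ_{a'} + σ_{a'} Z_{a'})`), if interior maximizers `ρ(α)` of
`V(·, α)` over `Δ_K` exist for small `α`, then as `α → 0⁺` they converge to the
Density Thompson Sampling allocation `ρ_a ∝ s_a sqrt(I_a)`. -/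
theorem stmt7 (K : ℕ) (hK : 2 ≤ K)
    (μ σ s : Fin K → ℝ) (hσ : ∀ a, 0 < σ a) (hs : ∀ a, 0 < s a)
    (I : Fin K → ℝ)
    (hI : ∀ a, I a = ∫ z, (1 / σ a) * stdNormalPDF
        (((⨆ a' : {b : Fin K // b ≠ a}, (μ a'.1 + σ a'.1 * z a'.1)) - μ a) / σ a)
      ∂(gaussPi K))
    (ε α₁ : ℝ) (hε : 0 < ε) (hα₁ : 0 < α₁)
    (ρfun : ℝ → (Fin K → ℝ))
    (hρmax : ∀ α : ℝ, 0 < α → α < α₁ →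
      ((∀ a, 0 ≤ ρfun α a) ∧ ∑ a, ρfun α a = 1) ∧
      (∀ ρ' : Fin K → ℝ, ((∀ a, 0 ≤ ρ' a) ∧ ∑ a, ρ' a = 1) →
        Vplan K μ σ s ρ' α ≤ Vplan K μ σ s (ρfun α) α) ∧
      (∀ a, ε < ρfun α a)) :
    (∀ a, 0 < I a) ∧
    ∀ a : Fin K,
      Tendsto (fun α : ℝ => ρfun α a) (𝓝[>] 0)
        (𝓝 (s a * Real.sqrt (I a) / ∑ a', s a' * Real.sqrt (I a'))) := by
  have : Nontrivial (Fin K) := Fin.nontrivial_iff_two_le.2 hK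
  have hIJ (a : Fin K) :
      I a = (∫ z, stdNormalPDF (rivalLevel μ σ a z) ∂gaussPi K) / σ a := by
    rw [hI, integral_const_mul, one_div_mul_eq_div]
    rfl
  have hIpos (a : Fin K) : 0 < I a := by
    rw [hIJ]
    exact div_pos (integral_stdNormalPDF_rivalLevel_pos μ σ a) (hσ a)
  refine ⟨hIpos, ?_⟩
  let w : Fin K → ℝ := fun a => s a * Real.sqrt (I a)
  have hw (a : Fin K) : 0 < w a := mul_pos (hs a) (Real.sqrt_pos.2 (hIpos a))
  have hS : 0 < ∑ b, w b := Finset.sum_pos (fun a _ => hw a) Finset.univ_nonempty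
  let p : Fin K → ℝ := fun a => w a / ∑ b, w b
  have hp (a : Fin K) : 0 < p a := div_pos (hw a) hS
  have hpsum : ∑ a, p a = 1 := by
    rw [← Finset.sum_div, div_self hS.ne']
  obtain ⟨δ, hδ, hδp⟩ : ∃ δ > 0, ∀ a, δ < p a := by
    obtain ⟨a₀, ha₀⟩ := Finite.exists_min p
    exact ⟨p a₀ / 2, half_pos (hp a₀), fun a => (half_lt_self (hp a₀)).trans_le (ha₀ a)⟩
  have hsmall : ∀ᶠ α in 𝓝[>] (0 : ℝ), 0 < α ∧ α < α₁ := Ioo_mem_nhdsGT hα₁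
  have hcost (ρ : Fin K → ℝ) :
      ∑ a, s a ^ 2 / (2 * ρ a * σ a) * ∫ z, stdNormalPDF (rivalLevel μ σ a z) ∂gaussPi K
        = (∑ a, w a ^ 2 / ρ a) / 2 := by
    rw [Finset.sum_div]
    refine Finset.sum_congr rfl fun a _ => ?_
    rw [mul_pow, Real.sq_sqrt (hIpos a).le, hIJ]
    simp only [div_eq_mul_inv, mul_inv]
    ring
  have hpcost : ∑ a, w a ^ 2 / p a = (∑ b, w b) ^ 2 := by
    have h (a : Fin K) : w a ^ 2 / p a = w a * ∑ b, w b := by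
      have := (hw a).ne'
      simp only [p]
      field_simp
    simp_rw [h]
    rw [← Finset.sum_mul, sq]
  have hE := (Vplan_expansion_isLittleO (μ := μ) (s := s) hσ hε (r := ρfun)
    (hsmall.mono fun α h => (hρmax α h.1 h.2).2.2)).sub
    (Vplan_expansion_isLittleO (μ := μ) (s := s) hσ hδ (r := fun _ => p)
      (Eventually.of_forall fun _ => hδp))
  have hlim := hE.tendsto_div_nhds_zero.const_mul 2
  rw [mul_zero] at hlim
  intro a
  have hsq : Tendsto (fun α => (w a - ρfun α a * ∑ b, w b) ^ 2) (𝓝[>] 0) (𝓝 0) := by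
    refine squeeze_zero' (Eventually.of_forall fun α => sq_nonneg _) ?_ hlim
    filter_upwards [hsmall] with α ⟨h0, h1⟩
    obtain ⟨⟨hnn, hsum⟩, hmax, hlow⟩ := hρmax α h0 h1
    refine (sq_sub_le_sum_sq_div (fun b => hε.trans (hlow b)) hsum a).trans ?_
    have hV := hmax p ⟨fun b => (hp b).le, hpsum⟩
    rw [hcost, hcost, hpcost, ← mul_div_assoc, le_div_iff₀ h0]
    linarith
  have habs : Tendsto (fun α => w a - ρfun α a * ∑ b, w b) (𝓝[>] 0) (𝓝 0) :=
    (tendsto_zero_iff_abs_tendsto_zero _).2 <| by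
      simpa [Real.sqrt_sq_eq_abs, Function.comp_def] using hsq.sqrt
  have hfin := (tendsto_const_nhds (x := w a)).sub habs |>.div_const (∑ b, w b)
  rw [sub_zero] at hfin
  refine hfin.congr fun α => ?_
  rw [sub_sub_cancel, mul_div_cancel_right₀ _ hS.ne']
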